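/- arXiv:1512.04403 — 2 statements merged into one kernel-verified Lean document; each statement's English description precedes it below -/
import Mathlib

section
/- Suppose the project is PCL-indexable, i.e., conditions (PCLI1), (PCLI2) and (PCLI3) hold. Then the project is strongly threshold-indexable with index m*: it is indexable with index m*, and for every price λ ∈ ℝ there exists a threshold z ∈ ℝ ∪ {−∞,∞} such that both the z-policy and the z⁻-policy are P_λ-optimal. -/
open MeasureTheory ProbabilityTheory Filter Topology Set

noncomputable section

/-- A restless bandit project: the model data (discount factor `β`, passive/active
Markov transition kernels `κ false`/`κ true`, reward `r` and resource consumption `c`),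
Assumption 1 (the weighted sup-norm conditions for weight `w` and constants `M`, `γ`),
together with the threshold-policy performance metrics `F`, `G` (for `z`-policies,
active iff `x > z`), `Fm`, `Gm` (for `z⁻`-policies, active iff `x ≥ z`), and the
optimal value function `V lam` of the `lam`-price problem, each of which is the
(unique) `w`-bounded measurable solution of its fixed-point equation. -/
structure Bandit where
  β : ℝ
  κ : Bool → Kernel ℝ ℝ
  r : ℝ → Bool → ℝ
  c : ℝ → Bool → ℝ
  w : ℝ → ℝ
  M : ℝ
  γ : ℝ
  F : ℝ → EReal → ℝ
  G : ℝ → EReal → ℝ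
  Fm : ℝ → EReal → ℝ
  Gm : ℝ → EReal → ℝ
  V : ℝ → ℝ → ℝ
  hβ0 : 0 ≤ β
  hβ1 : β < 1
  hκ : ∀ a, IsMarkovKernel (κ a)
  hr_cont : ∀ a, Continuous fun x => r x a
  hc_cont : ∀ a, Continuous fun x => c x a
  hc0 : ∀ x, 0 ≤ c x false
  hc01 : ∀ x, c x false < c x true
  hw_meas : Measurable w
  hw_one : ∀ x, 1 ≤ w x
  hM : 0 < M
  hβγ : β ≤ γ
  hγ1 : γ < 1
  hr_bd : ∀ x a, |r x a| ≤ M * w x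
  hc_bd : ∀ x a, c x a ≤ M * w x
  hw_int : ∀ a x, Integrable w (κ a x)
  hw_drift : ∀ a x, β * ∫ y, w y ∂(κ a x) ≤ γ * w x
  hF_meas : ∀ z, Measurable fun x => F x z
  hG_meas : ∀ z, Measurable fun x => G x z
  hFm_meas : ∀ z, Measurable fun x => Fm x z
  hGm_meas : ∀ z, Measurable fun x => Gm x z
  hV_meas : ∀ lam, Measurable (V lam)
  hF_bdd : ∀ z, ∃ C, ∀ x, |F x z| ≤ C * w x
  hG_bdd : ∀ z, ∃ C, ∀ x, |G x z| ≤ C * w x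
  hFm_bdd : ∀ z, ∃ C, ∀ x, |Fm x z| ≤ C * w x
  hGm_bdd : ∀ z, ∃ C, ∀ x, |Gm x z| ≤ C * w x
  hV_bdd : ∀ lam, ∃ C, ∀ x, |V lam x| ≤ C * w x
  hF_eq : ∀ x z, F x z =
    r x (decide (z < (x : EReal))) +
      β * ∫ y, F y z ∂(κ (decide (z < (x : EReal))) x)
  hG_eq : ∀ x z, G x z =
    c x (decide (z < (x : EReal))) +
      β * ∫ y, G y z ∂(κ (decide (z < (x : EReal))) x)
  hFm_eq : ∀ x z, Fm x z =
    r x (decide (z ≤ (x : EReal))) +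
      β * ∫ y, Fm y z ∂(κ (decide (z ≤ (x : EReal))) x)
  hGm_eq : ∀ x z, Gm x z =
    c x (decide (z ≤ (x : EReal))) +
      β * ∫ y, Gm y z ∂(κ (decide (z ≤ (x : EReal))) x)
  hV_eq : ∀ lam x, V lam x =
    max (r x false - lam * c x false + β * ∫ y, V lam y ∂(κ false x))
        (r x true - lam * c x true + β * ∫ y, V lam y ∂(κ true x))

/-- `ν` is the Lebesgue–Stieltjes measure of the (bounded nonincreasing
right-continuous) function `h`: `ν(z₁,z₂] = h z₁ - h z₂`. -/
def IsLSMeasureOfAnti (h : ℝ → ℝ) (ν : Measure ℝ) : Prop :=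
  ∀ z₁ z₂ : ℝ, z₁ ≤ z₂ → ν (Set.Ioc z₁ z₂) = ENNReal.ofReal (h z₁ - h z₂)

/-- `ν` is the Lebesgue–Stieltjes measure of the (bounded nondecreasing
right-continuous) function `h`: `ν(z₁,z₂] = h z₂ - h z₁`. -/
def IsLSMeasureOfMono (h : ℝ → ℝ) (ν : Measure ℝ) : Prop :=
  ∀ z₁ z₂ : ℝ, z₁ ≤ z₂ → ν (Set.Ioc z₁ z₂) = ENNReal.ofReal (h z₂ - h z₁)

/-- The real interval `(z₁, z₂] ⊆ ℝ` with extended-real endpoints. -/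
def iocR (z₁ z₂ : EReal) : Set ℝ := {y : ℝ | z₁ < (y : EReal) ∧ (y : EReal) ≤ z₂}

/-- `t`-step distribution of the Markov chain with kernel `κ` and initial law `p`. -/
def kerIter (κ : Kernel ℝ ℝ) : ℕ → Measure ℝ → Measure ℝ
  | 0, p => p
  | (t + 1), p => (kerIter κ t p).bind fun x => κ x

namespace Bandit

variable (P : Bandit)

/-- Marginal reward metric `f(x,z)` of the `z`-policy. -/
def f (x : ℝ) (z : EReal) : ℝ :=
  (P.r x true - P.r x false) +
    P.β * ((∫ y, P.F y z ∂(P.κ true x)) - ∫ y, P.F y z ∂(P.κ false x))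

/-- Marginal resource metric `g(x,z)` of the `z`-policy. -/
def g (x : ℝ) (z : EReal) : ℝ :=
  (P.c x true - P.c x false) +
    P.β * ((∫ y, P.G y z ∂(P.κ true x)) - ∫ y, P.G y z ∂(P.κ false x))

/-- Marginal reward metric `f(x,z⁻)` of the `z⁻`-policy. -/
def fm (x : ℝ) (z : EReal) : ℝ :=
  (P.r x true - P.r x false) +
    P.β * ((∫ y, P.Fm y z ∂(P.κ true x)) - ∫ y, P.Fm y z ∂(P.κ false x))

/-- Marginal resource metric `g(x,z⁻)` of the `z⁻`-policy. -/
def gm (x : ℝ) (z : EReal) : ℝ :=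
  (P.c x true - P.c x false) +
    P.β * ((∫ y, P.Gm y z ∂(P.κ true x)) - ∫ y, P.Gm y z ∂(P.κ false x))

/-- Marginal productivity metric `m(x,z) = f(x,z)/g(x,z)`. -/
def m (x : ℝ) (z : EReal) : ℝ := P.f x z / P.g x z

/-- Marginal productivity metric `m(x,z⁻) = f(x,z⁻)/g(x,z⁻)`. -/
def mm (x : ℝ) (z : EReal) : ℝ := P.fm x z / P.gm x z

/-- The marginal productivity (MP) index `m*(x) = m(x,x)`. -/
def mStar (x : ℝ) : ℝ := P.m x (x : EReal)

/-- The active action is `P_lam`-optimal at `x`. -/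
def ActOpt (lam x : ℝ) : Prop :=
  P.r x false - lam * P.c x false + P.β * ∫ y, P.V lam y ∂(P.κ false x) ≤
    P.r x true - lam * P.c x true + P.β * ∫ y, P.V lam y ∂(P.κ true x)

/-- The passive action is `P_lam`-optimal at `x`. -/
def PassOpt (lam x : ℝ) : Prop :=
  P.r x true - lam * P.c x true + P.β * ∫ y, P.V lam y ∂(P.κ true x) ≤
    P.r x false - lam * P.c x false + P.β * ∫ y, P.V lam y ∂(P.κ false x)

/-- The project is indexable with index `ν`. -/
def Indexable (ν : ℝ → ℝ) : Prop :=
  ∀ lam x, (P.ActOpt lam x ↔ lam ≤ ν x) ∧ (P.PassOpt lam x ↔ ν x ≤ lam)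

/-- The `z`-policy is `P_lam`-optimal. -/
def ZPolicyOpt (z : EReal) (lam : ℝ) : Prop :=
  ∀ x, P.F x z - lam * P.G x z = P.V lam x

/-- The `z⁻`-policy is `P_lam`-optimal. -/
def ZmPolicyOpt (z : EReal) (lam : ℝ) : Prop :=
  ∀ x, P.Fm x z - lam * P.Gm x z = P.V lam x

/-- The project is strongly threshold-indexable with index `ν`. -/
def StronglyThresholdIndexable (ν : ℝ → ℝ) : Prop :=
  P.Indexable ν ∧
    ∀ lam : ℝ, ∃ z : EReal, P.ZPolicyOpt z lam ∧ P.ZmPolicyOpt z lam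

/-- PCL-indexability condition (PCLI1). -/
def PCLI1 : Prop := ∀ (x : ℝ) (z : EReal), 0 < P.g x z

/-- PCL-indexability condition (PCLI2). -/
def PCLI2 : Prop :=
  Monotone P.mStar ∧ Continuous P.mStar ∧ BddBelow (Set.range P.mStar)

/-- PCL-indexability condition (PCLI3). -/
def PCLI3 : Prop :=
  ∀ x : ℝ, ∀ ν : Measure ℝ, IsLSMeasureOfAnti (fun z : ℝ => P.G x z) ν →
    ∀ z₁ z₂ : ℝ, z₁ < z₂ →
      P.F x z₂ - P.F x z₁ = -∫ z in Set.Ioc z₁ z₂, P.mStar z ∂ν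

/-- The project is PCL-indexable. -/
def PCLIndexable : Prop := P.PCLI1 ∧ P.PCLI2 ∧ P.PCLI3

/-- Reward metric with initial distribution `p`. -/
def Fp (p : Measure ℝ) (z : EReal) : ℝ := ∫ x, P.F x z ∂p

/-- Resource metric with initial distribution `p`. -/
def Gp (p : Measure ℝ) (z : EReal) : ℝ := ∫ x, P.G x z ∂p

/-- `z⁻`-policy reward metric with initial distribution `p`. -/
def Fmp (p : Measure ℝ) (z : EReal) : ℝ := ∫ x, P.Fm x z ∂p

/-- `z⁻`-policy resource metric with initial distribution `p`. -/
def Gmp (p : Measure ℝ) (z : EReal) : ℝ := ∫ x, P.Gm x z ∂p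

/-- An admissible initial distribution: a probability measure with `∫ w dp < ∞`. -/
def IsInitDist (p : Measure ℝ) : Prop :=
  IsProbabilityMeasure p ∧ Integrable P.w p

/-- The transition kernel of the `z`-policy (active iff `x > z`). -/
def thrKer (z : EReal) : Kernel ℝ ℝ :=
  haveI : DecidablePred (· ∈ {x : ℝ | z < (x : EReal)}) := Classical.decPred _
  Kernel.piecewise
    (show MeasurableSet {x : ℝ | z < (x : EReal)} from
      measurable_coe_real_ereal measurableSet_Ioi)
    (P.κ true) (P.κ false)

/-- The transition kernel of the `z⁻`-policy (active iff `x ≥ z`). -/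
def thrKerM (z : EReal) : Kernel ℝ ℝ :=
  haveI : DecidablePred (· ∈ {x : ℝ | z ≤ (x : EReal)}) := Classical.decPred _
  Kernel.piecewise
    (show MeasurableSet {x : ℝ | z ≤ (x : EReal)} from
      measurable_coe_real_ereal measurableSet_Ici)
    (P.κ true) (P.κ false)

/-- The (discounted) state occupation measure `μ_p^z` of the `z`-policy. -/
def occ (z : EReal) (p : Measure ℝ) : Measure ℝ :=
  Measure.sum fun t : ℕ => ENNReal.ofReal (P.β ^ t) • kerIter (P.thrKer z) t p

/-- The (discounted) state occupation measure `μ_p^{z⁻}` of the `z⁻`-policy. -/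
def occM (z : EReal) (p : Measure ℝ) : Measure ℝ :=
  Measure.sum fun t : ℕ => ENNReal.ofReal (P.β ^ t) • kerIter (P.thrKerM z) t p

end Bandit

/-- Finite-horizon reward metric `F_k(x,z)` (value iteration). -/
def Bandit.Fk (P : Bandit) : ℕ → ℝ → EReal → ℝ
  | 0, x, z => P.r x (decide (z < (x : EReal)))
  | (k + 1), x, z =>
      P.r x (decide (z < (x : EReal))) +
        P.β * ∫ y, Bandit.Fk P k y z ∂(P.κ (decide (z < (x : EReal))) x)

/-- Finite-horizon resource metric `G_k(x,z)` (value iteration). -/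
def Bandit.Gk (P : Bandit) : ℕ → ℝ → EReal → ℝ
  | 0, x, z => P.c x (decide (z < (x : EReal)))
  | (k + 1), x, z =>
      P.c x (decide (z < (x : EReal))) +
        P.β * ∫ y, Bandit.Gk P k y z ∂(P.κ (decide (z < (x : EReal))) x)

/-- Finite-horizon marginal reward metric `f_k(x,z)`. -/
def Bandit.fk (P : Bandit) : ℕ → ℝ → EReal → ℝ
  | 0, x, _ => P.r x true - P.r x false
  | (k + 1), x, z =>
      (P.r x true - P.r x false) +
        P.β * ((∫ y, P.Fk k y z ∂(P.κ true x)) - ∫ y, P.Fk k y z ∂(P.κ false x))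

/-- Finite-horizon marginal resource metric `g_k(x,z)`. -/
def Bandit.gk (P : Bandit) : ℕ → ℝ → EReal → ℝ
  | 0, x, _ => P.c x true - P.c x false
  | (k + 1), x, z =>
      (P.c x true - P.c x false) +
        P.β * ((∫ y, P.Gk k y z ∂(P.κ true x)) - ∫ y, P.Gk k y z ∂(P.κ false x))

namespace Bandit

variable (P : Bandit)

/-- Finite-horizon MP metric `m_k(x,z)`. -/
def mk' (k : ℕ) (x : ℝ) (z : EReal) : ℝ := P.fk k x z / P.gk k x z

/-- Finite-horizon MP index `m*_k(x)`. -/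
def mkStar (k : ℕ) (x : ℝ) : ℝ := P.mk' k x (x : EReal)

/-- `g̲(x,z) = inf_k g_k(x,z)`. -/
def gbar (x : ℝ) (z : EReal) : ℝ := ⨅ k : ℕ, P.gk k x z

end Bandit

/-- If `h` decreases on `[a, b]` up to an error which is a product of the increments of a continuous
monotone function and of an antitone function, then `h b ≤ h a`. -/
theorem le_of_increment_le_mul {m h A : ℝ → ℝ} (hm : Continuous m) {a b : ℝ} (hab : a ≤ b)
    (hinc : ∀ s t, a ≤ s → s ≤ t → t ≤ b → h t - h s ≤ (m t - m s) * (A s - A t)) :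
    h b ≤ h a := by
  have key : ∀ n : ℕ, ∀ s t, a ≤ s → s ≤ t → t ≤ b →
      h t - h s ≤ (m t - m s) / 2 ^ n * (A s - A t) := by
    intro n
    induction n with
    | zero => intro s t h1 h2 h3; simpa using hinc s t h1 h2 h3
    | succ n ih =>
      intro s t h1 h2 h3
      obtain ⟨c, hc, hmc⟩ : ∃ c ∈ Set.uIcc s t, m c = (m s + m t) / 2 :=
        intermediate_value_uIcc hm.continuousOn <| by
          rw [Set.mem_uIcc]
          rcases le_total (m s) (m t) with h | h
          · left; constructor <;> linarith
          · right; constructor <;> linarith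
      rw [Set.uIcc_of_le h2] at hc
      have e1 := ih s c h1 hc.1 (hc.2.trans h3)
      have e2 := ih c t (h1.trans hc.1) hc.2 h3
      have e3 : (m c - m s) / 2 ^ n = (m t - m s) / 2 ^ (n + 1) := by
        rw [hmc]; field_simp; ring
      have e4 : (m t - m c) / 2 ^ n = (m t - m s) / 2 ^ (n + 1) := by
        rw [hmc]; field_simp; ring
      rw [e3] at e1
      rw [e4] at e2
      linarith
  have hlim : Tendsto (fun n : ℕ => (m b - m a) * (1 / 2 : ℝ) ^ n * (A a - A b)) atTop
      (𝓝 ((m b - m a) * 0 * (A a - A b))) :=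
    ((tendsto_pow_atTop_nhds_zero_of_lt_one (by norm_num) (by norm_num)).const_mul _).mul_const _
  have := ge_of_tendsto' hlim fun n => by
    have := key n a b le_rfl hab le_rfl
    rwa [div_eq_mul_inv, ← inv_pow, ← one_div] at this
  linarith

namespace Bandit

variable (P : Bandit)

/-- `v` is a measurable function of finite weighted sup norm. -/
def IsWBounded (v : ℝ → ℝ) : Prop := Measurable v ∧ ∃ C, ∀ x, |v x| ≤ C * P.w x

/-- `v` is the discounted value of the stationary policy `a` for the one-stage payoff `ρ`. -/
def IsPolicyValue (ρ : ℝ → Bool → ℝ) (a : ℝ → Bool) (v : ℝ → ℝ) : Prop :=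
  P.IsWBounded v ∧ ∀ x, v x = ρ x (a x) + P.β * ∫ y, v y ∂(P.κ (a x) x)

variable {P}

theorem w_pos (x : ℝ) : 0 < P.w x := one_pos.trans_le (P.hw_one x)

theorem γ_nonneg : 0 ≤ P.γ := P.hβ0.trans P.hβγ

theorem integrable_of_bound {v : ℝ → ℝ} (hv : Measurable v) {C : ℝ}
    (hC : ∀ x, |v x| ≤ C * P.w x) (a : Bool) (x : ℝ) : Integrable v (P.κ a x) :=
  ((P.hw_int a x).const_mul C).mono' hv.aestronglyMeasurable (.of_forall hC)

namespace IsWBounded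

theorem integrable {v : ℝ → ℝ} (hv : P.IsWBounded v) (a : Bool) (x : ℝ) :
    Integrable v (P.κ a x) :=
  let ⟨_, hC⟩ := hv.2
  integrable_of_bound hv.1 hC a x

theorem w : P.IsWBounded P.w :=
  ⟨P.hw_meas, 1, fun x => by rw [abs_of_pos (w_pos x), one_mul]⟩

theorem const_mul {v : ℝ → ℝ} (hv : P.IsWBounded v) (k : ℝ) :
    P.IsWBounded fun x => k * v x := by
  obtain ⟨hm, C, hC⟩ := hv
  refine ⟨hm.const_mul k, |k| * C, fun x => ?_⟩
  rw [abs_mul, mul_assoc]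
  exact mul_le_mul_of_nonneg_left (hC x) (abs_nonneg k)

theorem sub {u v : ℝ → ℝ} (hu : P.IsWBounded u) (hv : P.IsWBounded v) :
    P.IsWBounded fun x => u x - v x := by
  obtain ⟨hmu, C, hC⟩ := hu
  obtain ⟨hmv, B, hB⟩ := hv
  refine ⟨hmu.sub hmv, C + B, fun x => ?_⟩
  rw [add_mul]
  exact (abs_sub _ _).trans (add_le_add (hC x) (hB x))

/-- A weighted-bounded function dominated at every state by its own discounted expectation under
some action is nonpositive. -/
theorem nonpos {D : ℝ → ℝ} (hD : P.IsWBounded D)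
    (h : ∀ x, ∃ a, D x ≤ P.β * ∫ y, D y ∂(P.κ a x)) (x : ℝ) : D x ≤ 0 := by
  obtain ⟨C, hC⟩ := hD.2
  have hC0 : 0 ≤ C :=
    nonneg_of_mul_nonneg_left ((abs_nonneg _).trans (hC 0)) (w_pos 0)
  have key : ∀ n : ℕ, ∀ x, D x ≤ C * P.γ ^ n * P.w x := by
    intro n
    induction n with
    | zero => intro x; simpa using (le_abs_self _).trans (hC x)
    | succ n ih =>
      intro x
      obtain ⟨a, ha⟩ := h x
      calc D x ≤ P.β * ∫ y, D y ∂(P.κ a x) := ha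
        _ ≤ P.β * ∫ y, C * P.γ ^ n * P.w y ∂(P.κ a x) :=
          mul_le_mul_of_nonneg_left
            (integral_mono (hD.integrable a x) ((P.hw_int a x).const_mul _) ih) P.hβ0
        _ = C * P.γ ^ n * (P.β * ∫ y, P.w y ∂(P.κ a x)) := by
          rw [integral_const_mul]; ring
        _ ≤ C * P.γ ^ n * (P.γ * P.w x) :=
          mul_le_mul_of_nonneg_left (P.hw_drift a x)
            (mul_nonneg hC0 (pow_nonneg γ_nonneg n))
        _ = C * P.γ ^ (n + 1) * P.w x := by ring
  have hlim : Tendsto (fun n : ℕ => C * P.γ ^ n * P.w x) atTop (𝓝 (C * 0 * P.w x)) :=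
    ((tendsto_pow_atTop_nhds_zero_of_lt_one γ_nonneg P.hγ1).const_mul C).mul_const _
  simpa using ge_of_tendsto' hlim fun n => key n x

/-- The Bellman equation has at most one weighted-bounded solution. -/
theorem eq_V {v : ℝ → ℝ} (hv : P.IsWBounded v) {lam : ℝ}
    (h : ∀ x, v x = max (P.r x false - lam * P.c x false + P.β * ∫ y, v y ∂(P.κ false x))
      (P.r x true - lam * P.c x true + P.β * ∫ y, v y ∂(P.κ true x))) (x : ℝ) :
    v x = P.V lam x := by
  have hV : P.IsWBounded (P.V lam) := ⟨P.hV_meas lam, P.hV_bdd lam⟩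
  have aux : ∀ {u u' : ℝ → ℝ}, P.IsWBounded u → P.IsWBounded u' →
      (∀ x, u x = max (P.r x false - lam * P.c x false + P.β * ∫ y, u y ∂(P.κ false x))
        (P.r x true - lam * P.c x true + P.β * ∫ y, u y ∂(P.κ true x))) →
      (∀ x, u' x = max (P.r x false - lam * P.c x false + P.β * ∫ y, u' y ∂(P.κ false x))
        (P.r x true - lam * P.c x true + P.β * ∫ y, u' y ∂(P.κ true x))) →
      ∀ x, u x ≤ u' x := by
    intro u u' hu hu' e e' x
    refine sub_nonpos.1 ((hu.sub hu').nonpos (fun x => ?_) x)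
    have h1 := e' x ▸ le_max_left (P.r x false - lam * P.c x false + P.β * ∫ y, u' y ∂(P.κ false x))
      (P.r x true - lam * P.c x true + P.β * ∫ y, u' y ∂(P.κ true x))
    have h2 := e' x ▸ le_max_right (P.r x false - lam * P.c x false + P.β * ∫ y, u' y ∂(P.κ false x))
      (P.r x true - lam * P.c x true + P.β * ∫ y, u' y ∂(P.κ true x))
    rcases max_choice (P.r x false - lam * P.c x false + P.β * ∫ y, u y ∂(P.κ false x))
      (P.r x true - lam * P.c x true + P.β * ∫ y, u y ∂(P.κ true x)) with hc | hc
    · refine ⟨false, ?_⟩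
      rw [integral_sub (hu.integrable _ _) (hu'.integrable _ _), e x, hc]
      linarith
    · refine ⟨true, ?_⟩
      rw [integral_sub (hu.integrable _ _) (hu'.integrable _ _), e x, hc]
      linarith
  exact le_antisymm (aux hv hV h (P.hV_eq lam) x) (aux hV hv (P.hV_eq lam) h x)

end IsWBounded

namespace IsPolicyValue

variable {ρ : ℝ → Bool → ℝ} {a : ℝ → Bool} {u v : ℝ → ℝ}

theorem eq (hu : P.IsPolicyValue ρ a u) (hv : P.IsPolicyValue ρ a v) (x : ℝ) : u x = v x := by
  have aux : ∀ {u v : ℝ → ℝ}, P.IsPolicyValue ρ a u → P.IsPolicyValue ρ a v →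
      ∀ x, u x ≤ v x := by
    intro u v hu hv x
    refine sub_nonpos.1 ((hu.1.sub hv.1).nonpos (fun x => ⟨a x, ?_⟩) x)
    rw [integral_sub (hu.1.integrable _ _) (hv.1.integrable _ _), hu.2 x, hv.2 x]
    linarith
  exact le_antisymm (aux hu hv x) (aux hv hu x)

theorem sub_const_mul {ρ' : ℝ → Bool → ℝ} (hu : P.IsPolicyValue ρ a u)
    (hv : P.IsPolicyValue ρ' a v) (k : ℝ) :
    P.IsPolicyValue (fun x b => ρ x b - k * ρ' x b) a fun x => u x - k * v x := by
  refine ⟨hu.1.sub (hv.1.const_mul k), fun x => ?_⟩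
  rw [integral_sub (hu.1.integrable _ _) ((hv.1.const_mul k).integrable _ _),
    integral_const_mul]
  beta_reduce
  rw [hu.2 x, hv.2 x]
  ring

theorem abs_le {K : ℝ} (hρ : ∀ x b, |ρ x b| ≤ K * P.w x) (hv : P.IsPolicyValue ρ a v) (x : ℝ) :
    |v x| ≤ K / (1 - P.γ) * P.w x := by
  have h1 : 0 < 1 - P.γ := sub_pos.2 P.hγ1
  have hK : 0 ≤ K :=
    nonneg_of_mul_nonneg_left ((abs_nonneg _).trans (hρ 0 true)) (w_pos 0)
  set K' := K / (1 - P.γ) with hK'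
  have hK0 : 0 ≤ K' := div_nonneg hK h1.le
  have hKK : K = K' * (1 - P.γ) := (div_mul_cancel₀ K h1.ne').symm
  have drift : ∀ x, P.β * (K' * ∫ y, P.w y ∂(P.κ (a x) x)) + K * P.w x ≤ K' * P.w x := by
    intro x
    have := mul_le_mul_of_nonneg_left (P.hw_drift (a x) x) hK0
    rw [hKK]
    linarith
  rw [_root_.abs_le]
  constructor
  · have := ((hv.1.const_mul (-1)).sub (IsWBounded.w.const_mul K')).nonpos (fun x => ⟨a x, ?_⟩) x
    · linarith
    · rw [integral_sub ((hv.1.const_mul _).integrable _ _)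
        ((IsWBounded.w.const_mul _).integrable _ _), integral_const_mul, integral_const_mul,
        hv.2 x]
      linarith [drift x, neg_abs_le (ρ x (a x)), hρ x (a x)]
  · have := (hv.1.sub (IsWBounded.w.const_mul K')).nonpos (fun x => ⟨a x, ?_⟩) x
    · linarith
    · rw [integral_sub (hv.1.integrable _ _)
        ((IsWBounded.w.const_mul _).integrable _ _), integral_const_mul, hv.2 x]
      linarith [drift x, le_abs_self (ρ x (a x)), hρ x (a x)]

/-- Policy values depend continuously on the policy, for pointwise convergence of policies. -/
theorem tendsto {ι : Type*} {l : Filter ι} [l.IsCountablyGenerated] {K : ℝ}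
    (hρ : ∀ x b, |ρ x b| ≤ K * P.w x) (hv : P.IsPolicyValue ρ a v)
    {as : ι → ℝ → Bool} {vs : ι → ℝ → ℝ} (hvs : ∀ i, P.IsPolicyValue ρ (as i) (vs i))
    (has : ∀ x, ∀ᶠ i in l, as i x = a x) (x : ℝ) :
    Tendsto (fun i => vs i x) l (𝓝 (v x)) := by
  set C := 2 * (K / (1 - P.γ)) with hC
  have hD : ∀ i x, |vs i x - v x| ≤ C * P.w x := fun i x => by
    have h1 := (hvs i).abs_le hρ x
    have h2 := hv.abs_le hρ x
    have h3 := abs_sub (vs i x) (v x)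
    rw [hC]
    linarith
  have hC0 : 0 ≤ C := by
    have hK : 0 ≤ K :=
      nonneg_of_mul_nonneg_left ((abs_nonneg _).trans (hρ 0 true)) (w_pos 0)
    have := div_nonneg hK (sub_pos.2 P.hγ1).le
    rw [hC]
    linarith
  have hm : ∀ i, Measurable fun x => |vs i x - v x| := fun i => ((hvs i).1.1.sub hv.1.1).abs
  have key : ∀ k : ℕ, ∀ x,
      Tendsto (fun i => max (|vs i x - v x| - C * P.γ ^ k * P.w x) 0) l (𝓝 0) := by
    intro k
    induction k with
    | zero =>
      intro x
      refine tendsto_const_nhds.congr fun i => ?_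
      rw [max_eq_right]
      simpa using hD i x
    | succ k ih =>
      intro x
      have hCk : 0 ≤ C * P.γ ^ k := mul_nonneg hC0 (pow_nonneg γ_nonneg k)
      have hEm : ∀ i, Measurable fun y => max (|vs i y - v y| - C * P.γ ^ k * P.w y) 0 :=
        fun i => ((hm i).sub (P.hw_meas.const_mul _)).max measurable_const
      have hEb : ∀ i y, |max (|vs i y - v y| - C * P.γ ^ k * P.w y) 0| ≤ C * P.w y := by
        intro i y
        rw [abs_of_nonneg (le_max_right _ _)]
        refine max_le ?_ (mul_nonneg hC0 (w_pos y).le)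
        linarith [hD i y, mul_nonneg hCk (w_pos (P := P) y).le]
      have hint : Tendsto
          (fun i => ∫ y, max (|vs i y - v y| - C * P.γ ^ k * P.w y) 0 ∂(P.κ (a x) x)) l
          (𝓝 (∫ _, 0 ∂(P.κ (a x) x))) :=
        tendsto_integral_filter_of_dominated_convergence (fun y => C * P.w y)
          (.of_forall fun i => (hEm i).aestronglyMeasurable)
          (.of_forall fun i => .of_forall (hEb i)) ((P.hw_int _ _).const_mul C)
          (.of_forall ih)
      have hlim := hint.const_mul P.β
      rw [integral_zero, mul_zero] at hlim
      refine tendsto_of_tendsto_of_tendsto_of_le_of_le' tendsto_const_nhds hlim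
        (.of_forall fun i => le_max_right _ _) ?_
      filter_upwards [has x] with i hi
      have hvi := (hvs i).1
      refine max_le ?_ (mul_nonneg P.hβ0 (integral_nonneg fun y => le_max_right _ _))
      have e1 : vs i x - v x = P.β * ∫ y, (vs i y - v y) ∂(P.κ (a x) x) := by
        rw [integral_sub (hvi.integrable _ _) (hv.1.integrable _ _), (hvs i).2 x, hv.2 x, hi]
        ring
      have e2 : |vs i x - v x| ≤ P.β * ∫ y, |vs i y - v y| ∂(P.κ (a x) x) := by
        rw [e1, abs_mul, abs_of_nonneg P.hβ0]
        exact mul_le_mul_of_nonneg_left abs_integral_le_integral_abs P.hβ0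
      have hEi := integrable_of_bound (hEm i) (hEb i) (a x) x
      have e3 : ∫ y, |vs i y - v y| ∂(P.κ (a x) x) ≤
          ∫ y, (max (|vs i y - v y| - C * P.γ ^ k * P.w y) 0 + C * P.γ ^ k * P.w y)
            ∂(P.κ (a x) x) :=
        integral_mono ((hvi.sub hv.1).integrable _ _).abs
          (hEi.add ((P.hw_int _ _).const_mul _))
          fun y => sub_le_iff_le_add.1 (le_max_left _ _)
      rw [integral_add hEi ((P.hw_int _ _).const_mul _), integral_const_mul] at e3
      have e4 := mul_le_mul_of_nonneg_left e3 P.hβ0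
      have e5 := mul_le_mul_of_nonneg_left (P.hw_drift (a x) x) hCk
      rw [pow_succ]
      linarith
  rw [Metric.tendsto_nhds]
  intro ε hε
  have hpow : Tendsto (fun k : ℕ => C * P.γ ^ k * P.w x) atTop (𝓝 (C * 0 * P.w x)) :=
    ((tendsto_pow_atTop_nhds_zero_of_lt_one γ_nonneg P.hγ1).const_mul C).mul_const _
  rw [mul_zero, zero_mul] at hpow
  obtain ⟨k, hk⟩ := (hpow.eventually_lt_const (half_pos hε)).exists
  filter_upwards [(key k x).eventually_lt_const (half_pos hε)] with i hi
  rw [Real.dist_eq]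
  linarith [le_max_left (|vs i x - v x| - C * P.γ ^ k * P.w x) 0]

end IsPolicyValue

variable (P)

theorem isPolicyValue_F (z : EReal) :
    P.IsPolicyValue P.r (fun x => decide (z < (x : EReal))) fun x => P.F x z :=
  ⟨⟨P.hF_meas z, P.hF_bdd z⟩, fun x => P.hF_eq x z⟩

theorem isPolicyValue_G (z : EReal) :
    P.IsPolicyValue P.c (fun x => decide (z < (x : EReal))) fun x => P.G x z :=
  ⟨⟨P.hG_meas z, P.hG_bdd z⟩, fun x => P.hG_eq x z⟩

theorem isPolicyValue_Fm (z : EReal) :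
    P.IsPolicyValue P.r (fun x => decide (z ≤ (x : EReal))) fun x => P.Fm x z :=
  ⟨⟨P.hFm_meas z, P.hFm_bdd z⟩, fun x => P.hFm_eq x z⟩

theorem isPolicyValue_Gm (z : EReal) :
    P.IsPolicyValue P.c (fun x => decide (z ≤ (x : EReal))) fun x => P.Gm x z :=
  ⟨⟨P.hGm_meas z, P.hGm_bdd z⟩, fun x => P.hGm_eq x z⟩

theorem abs_c_le (x : ℝ) (a : Bool) : |P.c x a| ≤ P.M * P.w x := by
  rw [abs_of_nonneg]
  · exact P.hc_bd x a
  · cases a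
    · exact P.hc0 x
    · exact (P.hc0 x).trans (P.hc01 x).le

variable {P}

section Limits

variable {ι : Type*} {l : Filter ι} [l.IsCountablyGenerated] {ζ : ι → EReal} {z : EReal}

theorem tendsto_F (hζ : ∀ x : ℝ, ∀ᶠ i in l, (ζ i < x ↔ z < x)) (x : ℝ) :
    Tendsto (fun i => P.F x (ζ i)) l (𝓝 (P.F x z)) :=
  (P.isPolicyValue_F z).tendsto P.hr_bd (fun i => P.isPolicyValue_F (ζ i))
    (fun x => (hζ x).mono fun _ h => decide_eq_decide.2 h) x

theorem tendsto_G (hζ : ∀ x : ℝ, ∀ᶠ i in l, (ζ i < x ↔ z < x)) (x : ℝ) :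
    Tendsto (fun i => P.G x (ζ i)) l (𝓝 (P.G x z)) :=
  (P.isPolicyValue_G z).tendsto P.abs_c_le (fun i => P.isPolicyValue_G (ζ i))
    (fun x => (hζ x).mono fun _ h => decide_eq_decide.2 h) x

theorem tendsto_f (hζ : ∀ x : ℝ, ∀ᶠ i in l, (ζ i < x ↔ z < x)) (x : ℝ) :
    Tendsto (fun i => P.f x (ζ i)) l (𝓝 (P.f x z)) := by
  have (a : Bool) : Tendsto (fun i => ∫ y, P.F y (ζ i) ∂(P.κ a x)) l
      (𝓝 (∫ y, P.F y z ∂(P.κ a x))) :=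
    tendsto_integral_filter_of_dominated_convergence (fun y => P.M / (1 - P.γ) * P.w y)
      (.of_forall fun i => (P.hF_meas (ζ i)).aestronglyMeasurable)
      (.of_forall fun i => .of_forall ((P.isPolicyValue_F (ζ i)).abs_le P.hr_bd))
      ((P.hw_int a x).const_mul _) (.of_forall (tendsto_F hζ))
  exact (((this true).sub (this false)).const_mul P.β).const_add _

theorem tendsto_g (hζ : ∀ x : ℝ, ∀ᶠ i in l, (ζ i < x ↔ z < x)) (x : ℝ) :
    Tendsto (fun i => P.g x (ζ i)) l (𝓝 (P.g x z)) := by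
  have (a : Bool) : Tendsto (fun i => ∫ y, P.G y (ζ i) ∂(P.κ a x)) l
      (𝓝 (∫ y, P.G y z ∂(P.κ a x))) :=
    tendsto_integral_filter_of_dominated_convergence (fun y => P.M / (1 - P.γ) * P.w y)
      (.of_forall fun i => (P.hG_meas (ζ i)).aestronglyMeasurable)
      (.of_forall fun i => .of_forall ((P.isPolicyValue_G (ζ i)).abs_le P.abs_c_le))
      ((P.hw_int a x).const_mul _) (.of_forall (tendsto_G hζ))
  exact (((this true).sub (this false)).const_mul P.β).const_add _

end Limits

theorem eventually_coe_lt_iff_nhdsGE (z x : ℝ) :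
    ∀ᶠ t in 𝓝[≥] z, (((t : ℝ) : EReal) < x ↔ (z : EReal) < x) := by
  simp only [EReal.coe_lt_coe_iff]
  rcases lt_or_ge z x with h | h
  · filter_upwards [mem_nhdsWithin_of_mem_nhds (Iio_mem_nhds h)] with t ht
    exact iff_of_true ht h
  · filter_upwards [self_mem_nhdsWithin] with t ht
    exact iff_of_false (h.trans ht).not_gt h.not_gt

theorem eventually_coe_lt_iff_atTop (x : ℝ) :
    ∀ᶠ t : ℝ in atTop, ((t : EReal) < x ↔ (⊤ : EReal) < x) := by
  filter_upwards [eventually_ge_atTop x] with t ht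
  exact iff_of_false (EReal.coe_lt_coe_iff.not.2 ht.not_gt) not_top_lt

theorem eventually_coe_lt_iff_atBot (x : ℝ) :
    ∀ᶠ t : ℝ in atBot, ((t : EReal) < x ↔ (⊥ : EReal) < x) := by
  filter_upwards [eventually_lt_atBot x] with t ht
  exact iff_of_true (EReal.coe_lt_coe_iff.2 ht) (EReal.bot_lt_coe x)

theorem PCLI1.antitone_G (h : P.PCLI1) (x : ℝ) : Antitone fun z : ℝ => P.G x z := by
  intro s t hst
  have hs := P.isPolicyValue_G s
  have ht := P.isPolicyValue_G t
  refine sub_nonpos.1 ((ht.1.sub hs.1).nonpos (fun x => ⟨decide ((s : EReal) < x), ?_⟩) x)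
  rw [integral_sub (ht.1.integrable _ _) (hs.1.integrable _ _)]
  have es := hs.2 x
  have et := ht.2 x
  simp only [EReal.coe_lt_coe_iff] at es et ⊢
  by_cases h1 : t < x
  · simp only [h1, hst.trans_lt h1, decide_true] at es et ⊢
    linarith
  · by_cases h2 : s < x
    · simp only [h1, h2, decide_true, decide_false] at es et ⊢
      have := h x t
      rw [g] at this
      linarith
    · simp only [h1, h2, decide_false] at es et ⊢
      linarith

/-- Over a threshold interval the reward and resource increments have a ratio between the extreme
values of the index on that interval. -/
theorem PCLIndexable.F_sub_mem_Icc (h : P.PCLIndexable) (x : ℝ) {s t : ℝ} (hst : s ≤ t) :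
    P.F x s - P.F x t ∈
      Set.Icc (P.mStar s * (P.G x s - P.G x t)) (P.mStar t * (P.G x s - P.G x t)) := by
  rcases hst.eq_or_lt with rfl | hlt
  · simp
  have hG := h.1.antitone_G x
  let S : StieltjesFunction ℝ :=
    { toFun := fun z => -P.G x z
      mono' := fun a b hab => neg_le_neg (hG hab)
      right_continuous' := fun z => (tendsto_G (eventually_coe_lt_iff_nhdsGE z) x).neg }
  have hS : IsLSMeasureOfAnti (fun z : ℝ => P.G x z) S.measure := fun a b _ => by
    rw [S.measure_Ioc]
    congr 1
    change -P.G x b - -P.G x a = _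
    ring
  have hF := h.2.2 x S.measure hS s t hlt
  have hreal : S.measure.real (Set.Ioc s t) = P.G x s - P.G x t := by
    rw [Measure.real, hS s t hst, ENNReal.toReal_ofReal (sub_nonneg.2 (hG hst))]
  have hfin : S.measure (Set.Ioc s t) ≠ ⊤ := by
    rw [hS s t hst]; exact ENNReal.ofReal_ne_top
  have hint : IntegrableOn P.mStar (Set.Ioc s t) S.measure :=
    (h.2.1.2.1.integrableOn_Icc).mono_set Set.Ioc_subset_Icc_self
  have h1 := setIntegral_mono_on (integrableOn_const hfin) hint measurableSet_Ioc
    fun y hy => h.2.1.1 hy.1.le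
  have h2 := setIntegral_mono_on hint (integrableOn_const hfin) measurableSet_Ioc
    fun y hy => h.2.1.1 hy.2
  rw [setIntegral_const, hreal, smul_eq_mul] at h1 h2
  constructor <;> linarith

variable (P) in
/-- Marginal net metric `f(x,z) - m*(z) g(x,z)` of the `z`-policy at its own index. -/
def netMargin (x z : ℝ) : ℝ := P.f x z - P.mStar z * P.g x z

namespace PCLIndexable

theorem netMargin_self (h : P.PCLIndexable) (x : ℝ) : P.netMargin x x = 0 := by
  rw [netMargin, mStar, m, div_mul_cancel₀ _ (h.1 x x).ne', sub_self]

theorem netMargin_sub_mem_Icc (h : P.PCLIndexable) (x : ℝ) {s t : ℝ} (hst : s ≤ t) :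
    P.netMargin x s - P.netMargin x t ∈ Set.Icc
      ((P.mStar t - P.mStar s) * (P.g x t -
        (P.β * ∫ y, P.G y s ∂(P.κ false x) - P.β * ∫ y, P.G y t ∂(P.κ false x))))
      ((P.mStar t - P.mStar s) * (P.g x t +
        (P.β * ∫ y, P.G y s ∂(P.κ true x) - P.β * ∫ y, P.G y t ∂(P.κ true x)))) := by
  have iF (z : ℝ) (a : Bool) : Integrable (fun y => P.F y z) (P.κ a x) :=
    (P.isPolicyValue_F z).1.integrable a x
  have iG (z : ℝ) (a : Bool) : Integrable (fun y => P.G y z) (P.κ a x) :=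
    (P.isPolicyValue_G z).1.integrable a x
  have lower (a : Bool) : P.mStar s * (∫ y, P.G y s ∂(P.κ a x) - ∫ y, P.G y t ∂(P.κ a x)) ≤
      ∫ y, P.F y s ∂(P.κ a x) - ∫ y, P.F y t ∂(P.κ a x) := by
    rw [← integral_sub (iF s a) (iF t a), ← integral_sub (iG s a) (iG t a), ← integral_const_mul]
    exact integral_mono (((iG s a).sub (iG t a)).const_mul _) ((iF s a).sub (iF t a))
      fun y => (h.F_sub_mem_Icc y hst).1
  have upper (a : Bool) : ∫ y, P.F y s ∂(P.κ a x) - ∫ y, P.F y t ∂(P.κ a x) ≤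
      P.mStar t * (∫ y, P.G y s ∂(P.κ a x) - ∫ y, P.G y t ∂(P.κ a x)) := by
    rw [← integral_sub (iF s a) (iF t a), ← integral_sub (iG s a) (iG t a), ← integral_const_mul]
    exact integral_mono ((iF s a).sub (iF t a)) (((iG s a).sub (iG t a)).const_mul _)
      fun y => (h.F_sub_mem_Icc y hst).2
  have l0 := mul_le_mul_of_nonneg_left (lower false) P.hβ0
  have l1 := mul_le_mul_of_nonneg_left (lower true) P.hβ0
  have u0 := mul_le_mul_of_nonneg_left (upper false) P.hβ0
  have u1 := mul_le_mul_of_nonneg_left (upper true) P.hβ0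
  simp only [netMargin, f, g]
  constructor <;> linarith

theorem netMargin_eq_of_mStar_eq (h : P.PCLIndexable) (x : ℝ) {s t : ℝ} (hst : s ≤ t) (hm : P.mStar s = P.mStar t) :
    P.netMargin x s = P.netMargin x t := by
  have := h.netMargin_sub_mem_Icc x hst
  rw [hm, sub_self, zero_mul, zero_mul, Set.Icc_self, Set.mem_singleton_iff] at this
  exact sub_eq_zero.1 this

/-- If `g(x,·) ≥ δ` on `[s, t]`, the net margin drops there by at least `δ` times the increment of
the index. -/
theorem netMargin_add_le (h : P.PCLIndexable) (x : ℝ) {s t δ : ℝ} (hst : s ≤ t)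
    (hδ : ∀ z ∈ Set.Icc s t, δ ≤ P.g x z) :
    P.netMargin x t + δ * P.mStar t ≤ P.netMargin x s + δ * P.mStar s := by
  refine le_of_increment_le_mul (h := fun z => P.netMargin x z + δ * P.mStar z)
    (A := fun z => P.β * ∫ y, P.G y z ∂(P.κ false x)) h.2.1.2.1 hst ?_
  intro a b ha hab hb
  have h1 := (h.netMargin_sub_mem_Icc x hab).1
  have h2 := mul_le_mul_of_nonneg_left (hδ b ⟨ha.trans hab, hb⟩) (sub_nonneg.2 (h.2.1.1 hab))
  linarith

theorem antitone_netMargin (h : P.PCLIndexable) (x : ℝ) : Antitone (P.netMargin x) := fun s t hst => by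
  simpa using h.netMargin_add_le x hst fun z _ => (h.1 x z).le

theorem netMargin_lt (h : P.PCLIndexable) (x : ℝ) {s t : ℝ} (hm : P.mStar s < P.mStar t) :
    P.netMargin x t < P.netMargin x s := by
  have hmono := h.2.1.1
  have hst : s < t := hmono.reflect_lt hm
  have hcpt : IsCompact (Set.Icc s t ∩ P.mStar ⁻¹' {P.mStar s}) :=
    isCompact_Icc.inter_right (isClosed_singleton.preimage h.2.1.2.1)
  obtain ⟨q, ⟨hq, hmq⟩, hmax⟩ := hcpt.exists_isGreatest ⟨s, ⟨le_rfl, hst.le⟩, rfl⟩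
  rw [Set.mem_preimage, Set.mem_singleton_iff] at hmq
  have hqt : q < t := hmono.reflect_lt (hmq ▸ hm)
  have hev : ∀ᶠ z : ℝ in 𝓝[≥] q, P.g x q / 2 < P.g x z :=
    (tendsto_g (eventually_coe_lt_iff_nhdsGE q) x).eventually_const_lt (half_lt_self (h.1 x q))
  obtain ⟨u, hu, hsub⟩ := mem_nhdsGE_iff_exists_Icc_subset.1 hev
  have hqu : q < u := hu
  set p := min u t with hp
  have hqp : q < p := lt_min hqu hqt
  have hmp : P.mStar q < P.mStar p := by
    refine (hmono hqp.le).lt_of_ne fun he => hqp.not_ge (hmax ⟨⟨hq.1.trans hqp.le, ?_⟩, ?_⟩)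
    · exact min_le_right _ _
    · exact he.symm.trans hmq
  have hdrop := h.netMargin_add_le x hqp.le (δ := P.g x q / 2)
    fun z hz => (hsub ⟨hz.1, hz.2.trans (min_le_left _ _)⟩).le
  have hgap := mul_lt_mul_of_pos_left hmp (half_pos (h.1 x q))
  have h1 := h.antitone_netMargin x hq.1
  have h2 := h.antitone_netMargin x (min_le_right u t)
  linarith

/-- Every price admits a threshold whose marginal net metric has the sign prescribed by the
index. -/
theorem exists_threshold (h : P.PCLIndexable) (lam : ℝ) : ∃ z : EReal, ∀ x : ℝ,
    (0 ≤ P.f x z - lam * P.g x z ↔ lam ≤ P.mStar x) ∧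
    (P.f x z - lam * P.g x z ≤ 0 ↔ P.mStar x ≤ lam) ∧
    (z ≤ x → lam ≤ P.mStar x) ∧ (x ≤ z → P.mStar x ≤ lam) := by
  obtain ⟨hmono, hcont, -⟩ := h.2.1
  have hnet (x z : ℝ) :
      P.f x z - lam * P.g x z = P.netMargin x z + (P.mStar z - lam) * P.g x z := by
    rw [netMargin]; ring
  by_cases hr : ∃ z, P.mStar z = lam
  · obtain ⟨z, rfl⟩ := hr
    refine ⟨z, fun x => ?_⟩
    simp only [EReal.coe_le_coe_iff, hnet, sub_self, zero_mul, add_zero]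
    refine ⟨?_, ?_, fun hx => hmono hx, fun hx => hmono hx⟩
    · refine ⟨fun h0 => le_of_not_gt fun hlt => ?_, fun hle => ?_⟩
      · exact (h.netMargin_self x ▸ h.netMargin_lt x hlt).not_ge h0
      · rcases le_total z x with hx | hx
        · exact h.netMargin_self x ▸ h.antitone_netMargin x hx
        · exact (h.netMargin_self x ▸
            h.netMargin_eq_of_mStar_eq x hx ((hmono hx).antisymm hle)).le
    · refine ⟨fun h0 => le_of_not_gt fun hlt => ?_, fun hle => ?_⟩
      · exact (h.netMargin_self x ▸ h.netMargin_lt x hlt).not_ge h0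
      · rcases le_total x z with hx | hx
        · exact h.netMargin_self x ▸ h.antitone_netMargin x hx
        · exact (h.netMargin_self x ▸
            h.netMargin_eq_of_mStar_eq x hx ((hmono hx).antisymm hle)).le
  have hside : (∀ x, lam < P.mStar x) ∨ ∀ x, P.mStar x < lam := by
    by_contra! hc
    obtain ⟨⟨a, ha⟩, ⟨b, hb⟩⟩ := hc
    exact hr (mem_range_of_exists_le_of_exists_ge hcont ⟨a, ha⟩ ⟨b, hb⟩)
  rcases hside with hlam | hlam
  · refine ⟨⊥, fun x => ?_⟩
    have hlim := (tendsto_f (P := P) eventually_coe_lt_iff_atBot x).sub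
      ((tendsto_g (P := P) eventually_coe_lt_iff_atBot x).const_mul lam)
    have hpos : 0 < P.f x ⊥ - lam * P.g x ⊥ := by
      by_cases hz : ∃ z, P.mStar z < P.mStar x
      · obtain ⟨z, hz⟩ := hz
        refine (h.netMargin_self x ▸ h.netMargin_lt x hz).trans_le (ge_of_tendsto hlim ?_)
        filter_upwards [eventually_le_atBot z] with t ht
        rw [hnet]
        linarith [h.antitone_netMargin x ht,
          mul_nonneg (sub_nonneg.2 (hlam t).le) (h.1 x t).le]
      · push Not at hz
        refine (mul_pos (sub_pos.2 (hlam x)) (h.1 x ⊥)).trans_le (le_of_tendsto_of_tendsto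
          ((tendsto_g (P := P) eventually_coe_lt_iff_atBot x).const_mul _) hlim ?_)
        filter_upwards [eventually_le_atBot x] with t ht
        rw [hnet, (hmono ht).antisymm (hz t)]
        linarith [h.antitone_netMargin x ht, h.netMargin_self x]
    exact ⟨iff_of_true hpos.le (hlam x).le, iff_of_false hpos.not_ge (hlam x).not_ge,
      fun _ => (hlam x).le, fun hx => absurd (EReal.bot_lt_coe x) hx.not_gt⟩
  · refine ⟨⊤, fun x => ?_⟩
    have hlim := (tendsto_f (P := P) eventually_coe_lt_iff_atTop x).sub
      ((tendsto_g (P := P) eventually_coe_lt_iff_atTop x).const_mul lam)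
    have hneg : P.f x ⊤ - lam * P.g x ⊤ < 0 := by
      by_cases hz : ∃ z, P.mStar x < P.mStar z
      · obtain ⟨z, hz⟩ := hz
        refine (le_of_tendsto hlim ?_).trans_lt (h.netMargin_self x ▸ h.netMargin_lt x hz)
        filter_upwards [eventually_ge_atTop z] with t ht
        rw [hnet]
        linarith [h.antitone_netMargin x ht,
          mul_nonneg (sub_nonneg.2 (hlam t).le) (h.1 x t).le]
      · push Not at hz
        refine (le_of_tendsto_of_tendsto hlim
          ((tendsto_g (P := P) eventually_coe_lt_iff_atTop x).const_mul (P.mStar x - lam))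
          ?_).trans_lt (mul_neg_of_neg_of_pos (sub_neg.2 (hlam x)) (h.1 x ⊤))
        filter_upwards [eventually_ge_atTop x] with t ht
        rw [hnet, (hz t).antisymm (hmono ht)]
        linarith [h.antitone_netMargin x ht, h.netMargin_self x]
    exact ⟨iff_of_false hneg.not_ge (hlam x).not_ge, iff_of_true hneg.le (hlam x).le,
      fun hx => absurd (EReal.coe_lt_top x) hx.not_gt, fun _ => (hlam x).le⟩

end PCLIndexable

/-- A threshold policy satisfying the optimality conditions of its own marginal net metric is
optimal. -/
theorem zPolicyOpt_of_sign {z : EReal} {lam : ℝ}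
    (hact : ∀ x : ℝ, z < x → 0 ≤ P.f x z - lam * P.g x z)
    (hpas : ∀ x : ℝ, x ≤ z → P.f x z - lam * P.g x z ≤ 0) : P.ZPolicyOpt z lam := by
  have hF := P.isPolicyValue_F z
  have hG := P.isPolicyValue_G z
  have hv := hF.sub_const_mul hG lam
  refine hv.1.eq_V fun x => ?_
  have e := hv.2 x
  have hi (a : Bool) : ∫ y, (P.F y z - lam * P.G y z) ∂(P.κ a x) =
      ∫ y, P.F y z ∂(P.κ a x) - lam * ∫ y, P.G y z ∂(P.κ a x) := by
    rw [integral_sub (hF.1.integrable a x) ((hG.1.const_mul lam).integrable a x),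
      integral_const_mul]
  simp only [hi] at e ⊢
  rcases lt_or_ge z (x : EReal) with hx | hx
  · have := hact x hx
    simp only [hx, decide_true] at e
    rw [e, max_eq_right]
    rw [f, g] at this
    linarith
  · have := hpas x hx
    simp only [hx.not_gt, decide_false] at e
    rw [e, max_eq_left]
    rw [f, g] at this
    linarith

theorem ZPolicyOpt.margin_eq {z : EReal} {lam : ℝ} (hz : P.ZPolicyOpt z lam) (x : ℝ) :
    P.f x z - lam * P.g x z =
      (P.r x true - lam * P.c x true + P.β * ∫ y, P.V lam y ∂(P.κ true x)) -
      (P.r x false - lam * P.c x false + P.β * ∫ y, P.V lam y ∂(P.κ false x)) := by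
  have hi (a : Bool) : ∫ y, P.V lam y ∂(P.κ a x) =
      ∫ y, P.F y z ∂(P.κ a x) - lam * ∫ y, P.G y z ∂(P.κ a x) := by
    rw [← integral_const_mul, ← integral_sub ((P.isPolicyValue_F z).1.integrable a x)
      (((P.isPolicyValue_G z).1.const_mul lam).integrable a x)]
    exact integral_congr_ae (.of_forall fun y => (hz y).symm)
  rw [hi, hi, f, g]
  ring

theorem zmPolicyOpt_of_optimal {z : EReal} {lam : ℝ} (hact : ∀ x : ℝ, z ≤ x → P.ActOpt lam x)
    (hpas : ∀ x : ℝ, x < z → P.PassOpt lam x) : P.ZmPolicyOpt z lam := by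
  refine ((P.isPolicyValue_Fm z).sub_const_mul (P.isPolicyValue_Gm z) lam).eq
    ⟨⟨P.hV_meas lam, P.hV_bdd lam⟩, fun x => ?_⟩
  rw [P.hV_eq lam x]
  rcases le_or_gt z (x : EReal) with hx | hx
  · simp only [hx, decide_true]
    exact max_eq_right (hact x hx)
  · simp only [hx.not_ge, decide_false]
    exact max_eq_left (hpas x hx)

end Bandit

/-- **Verification theorem.** A PCL-indexable project is strongly
threshold-indexable with index `m*`. -/
theorem verification_theorem (P : Bandit) (h : P.PCLIndexable) :
    P.StronglyThresholdIndexable P.mStar := by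
  have key (lam : ℝ) : ∃ z : EReal, P.ZPolicyOpt z lam ∧
      (∀ x, (P.ActOpt lam x ↔ lam ≤ P.mStar x) ∧ (P.PassOpt lam x ↔ P.mStar x ≤ lam)) ∧
      (∀ x : ℝ, z ≤ x → lam ≤ P.mStar x) ∧ ∀ x : ℝ, x ≤ z → P.mStar x ≤ lam := by
    obtain ⟨z, hz⟩ := h.exists_threshold lam
    have hopt : P.ZPolicyOpt z lam :=
      Bandit.zPolicyOpt_of_sign (fun x hx => (hz x).1.2 ((hz x).2.2.1 hx.le))
        fun x hx => (hz x).2.1.2 ((hz x).2.2.2 hx)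
    refine ⟨z, hopt, fun x => ⟨?_, ?_⟩, fun x => (hz x).2.2.1, fun x => (hz x).2.2.2⟩
    · rw [← (hz x).1, hopt.margin_eq, sub_nonneg, Bandit.ActOpt]
    · rw [← (hz x).2.1, hopt.margin_eq, sub_nonpos, Bandit.PassOpt]
  refine ⟨fun lam => ?_, fun lam => ?_⟩
  · obtain ⟨z, -, hind, -⟩ := key lam
    exact hind
  · obtain ⟨z, hopt, hind, hact, hpas⟩ := key lam
    exact ⟨z, hopt, Bandit.zmPolicyOpt_of_optimal (fun x hx => (hind x).1.2 (hact x hx))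
      fun x hx => (hind x).2.2 (hpas x hx.le)⟩
end
end

section
/- Suppose the project is indexable with index λ* : ℝ → ℝ. Then the project is strongly threshold-indexable if and only if λ* is monotone nondecreasing and continuous. -/
open MeasureTheory ProbabilityTheory Filter Topology Set

noncomputable section

namespace Bandit

variable (P : Bandit)

/-- A measurable `w`-bounded function is integrable under every transition law. -/
lemma integrable_of_abs_le_mul_w {v : ℝ → ℝ} (hv : Measurable v)
    (hb : ∃ C, ∀ x, |v x| ≤ C * P.w x) (a : Bool) (x : ℝ) : Integrable v (P.κ a x) := by
  obtain ⟨C, hC⟩ := hb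
  exact ((P.hw_int a x).const_mul C).mono' hv.aestronglyMeasurable (ae_of_all _ hC)

/-- A `w`-bounded function equal to its discounted expectation one step ahead vanishes. -/
lemma eq_zero_of_eq_discounted {D : ℝ → ℝ} (u : ℝ → Bool)
    (hb : ∃ C, ∀ x, |D x| ≤ C * P.w x)
    (hD : ∀ x, D x = P.β * ∫ y, D y ∂(P.κ (u x) x)) (x : ℝ) : D x = 0 := by
  obtain ⟨C, hC⟩ := hb
  have hw0 : ∀ x, 0 < P.w x := fun x => one_pos.trans_le (P.hw_one x)
  have hC0 : 0 ≤ C :=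
    nonneg_of_mul_nonneg_left ((abs_nonneg (D 0)).trans (hC 0)) (hw0 0)
  have hγ0 : 0 ≤ P.γ := P.hβ0.trans P.hβγ
  have step : ∀ n : ℕ, ∀ x, |D x| ≤ C * P.γ ^ n * P.w x := by
    intro n
    induction n with
    | zero => simpa using hC
    | succ n ih =>
      intro x
      have hint : |∫ y, D y ∂(P.κ (u x) x)| ≤ C * P.γ ^ n * ∫ y, P.w y ∂(P.κ (u x) x) := by
        rw [← integral_const_mul, ← Real.norm_eq_abs]
        exact norm_integral_le_of_norm_le ((P.hw_int _ x).const_mul _) (ae_of_all _ ih)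
      calc |D x| = P.β * |∫ y, D y ∂(P.κ (u x) x)| := by
            rw [hD x, abs_mul, abs_of_nonneg P.hβ0]
        _ ≤ P.β * (C * P.γ ^ n * ∫ y, P.w y ∂(P.κ (u x) x)) :=
            mul_le_mul_of_nonneg_left hint P.hβ0
        _ = C * P.γ ^ n * (P.β * ∫ y, P.w y ∂(P.κ (u x) x)) := by ring
        _ ≤ C * P.γ ^ n * (P.γ * P.w x) :=
            mul_le_mul_of_nonneg_left (P.hw_drift _ x) (by positivity)
        _ = C * P.γ ^ (n + 1) * P.w x := by ring
  have hlim : Tendsto (fun n : ℕ => C * P.γ ^ n * P.w x) atTop (𝓝 0) := by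
    simpa using
      ((tendsto_pow_atTop_nhds_zero_of_lt_one hγ0 P.hγ1).const_mul C).mul_const (P.w x)
  exact abs_nonpos_iff.mp (ge_of_tendsto' hlim fun n => step n x)

/-- The value in state `x` of taking action `a` now and acting optimally afterwards. -/
def actionValue (lam x : ℝ) (a : Bool) : ℝ :=
  P.r x a - lam * P.c x a + P.β * ∫ y, P.V lam y ∂(P.κ a x)

lemma V_eq_actionValue_iff (lam x : ℝ) (a : Bool) :
    P.V lam x = P.actionValue lam x a ↔ P.actionValue lam x (!a) ≤ P.actionValue lam x a := by
  rw [P.hV_eq lam x]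
  cases a
  · exact max_eq_left_iff
  · exact max_eq_right_iff

variable {P}

lemma Indexable.V_eq_actionValue_iff {ν : ℝ → ℝ} (h : P.Indexable ν) (lam x : ℝ) (a : Bool) :
    P.V lam x = P.actionValue lam x a ↔ if a then lam ≤ ν x else ν x ≤ lam := by
  rw [P.V_eq_actionValue_iff]
  cases a
  · exact (h lam x).2
  · exact (h lam x).1

variable (P)

/-- A stationary policy is optimal iff it takes an optimal action in every state. -/
lemma policy_optimal_iff (u : ℝ → Bool) {A B : ℝ → ℝ} (hA : Measurable A) (hB : Measurable B)
    (hAb : ∃ C, ∀ x, |A x| ≤ C * P.w x) (hBb : ∃ C, ∀ x, |B x| ≤ C * P.w x)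
    (hAeq : ∀ x, A x = P.r x (u x) + P.β * ∫ y, A y ∂(P.κ (u x) x))
    (hBeq : ∀ x, B x = P.c x (u x) + P.β * ∫ y, B y ∂(P.κ (u x) x)) (lam : ℝ) :
    (∀ x, A x - lam * B x = P.V lam x) ↔ ∀ x, P.V lam x = P.actionValue lam x (u x) := by
  have hAi := P.integrable_of_abs_le_mul_w hA hAb
  have hBi := P.integrable_of_abs_le_mul_w hB hBb
  have hVi := P.integrable_of_abs_le_mul_w (P.hV_meas lam) (P.hV_bdd lam)
  have hsub : ∀ a x, ∫ y, (A y - lam * B y) ∂(P.κ a x) =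
      (∫ y, A y ∂(P.κ a x)) - lam * ∫ y, B y ∂(P.κ a x) := fun a x => by
    rw [integral_sub (hAi a x) ((hBi a x).const_mul lam), integral_const_mul]
  constructor
  · intro hopt x
    have hV : ∫ y, P.V lam y ∂(P.κ (u x) x) =
        (∫ y, A y ∂(P.κ (u x) x)) - lam * ∫ y, B y ∂(P.κ (u x) x) := by
      simp only [← hopt, hsub]
    rw [← hopt x, actionValue, hV, hAeq x, hBeq x]
    ring
  · intro hV x
    refine sub_eq_zero.mp
      (P.eq_zero_of_eq_discounted (D := fun x => A x - lam * B x - P.V lam x) u ?_ (fun x => ?_) x)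
    · obtain ⟨a, ha⟩ := hAb
      obtain ⟨b, hb⟩ := hBb
      obtain ⟨v, hv⟩ := P.hV_bdd lam
      refine ⟨a + |lam| * b + v, fun x => ?_⟩
      calc |A x - lam * B x - P.V lam x| ≤ |A x| + |lam * B x| + |P.V lam x| :=
            (abs_sub _ _).trans (by gcongr; exact abs_sub _ _)
        _ ≤ a * P.w x + |lam| * (b * P.w x) + v * P.w x := by
            rw [abs_mul]
            gcongr
            exacts [ha x, hb x, hv x]
        _ = _ := by ring
    · have hABi : Integrable (fun y => A y - lam * B y) (P.κ (u x) x) :=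
        (hAi _ x).sub ((hBi _ x).const_mul lam)
      rw [integral_sub hABi (hVi _ x), hsub, hV x,
        actionValue, hAeq x, hBeq x]
      ring

variable {P} {ν : ℝ → ℝ}

lemma Indexable.zPolicyOpt_iff (h : P.Indexable ν) (z : EReal) (lam : ℝ) :
    P.ZPolicyOpt z lam ↔
      ∀ x : ℝ, (z < x → lam ≤ ν x) ∧ ((x : EReal) ≤ z → ν x ≤ lam) := by
  refine (P.policy_optimal_iff (fun x => decide (z < (x : EReal))) (P.hF_meas z) (P.hG_meas z)
    (P.hF_bdd z) (P.hG_bdd z) (fun x => P.hF_eq x z) (fun x => P.hG_eq x z) lam).trans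
    (forall_congr' fun x => ?_)
  rw [h.V_eq_actionValue_iff]
  by_cases hz : z < (x : EReal)
  · simp [hz]
  · simp [hz, not_lt.mp hz]

lemma Indexable.zmPolicyOpt_iff (h : P.Indexable ν) (z : EReal) (lam : ℝ) :
    P.ZmPolicyOpt z lam ↔
      ∀ x : ℝ, (z ≤ x → lam ≤ ν x) ∧ ((x : EReal) < z → ν x ≤ lam) := by
  refine (P.policy_optimal_iff (fun x => decide (z ≤ (x : EReal))) (P.hFm_meas z) (P.hGm_meas z)
    (P.hFm_bdd z) (P.hGm_bdd z) (fun x => P.hFm_eq x z) (fun x => P.hGm_eq x z) lam).trans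
    (forall_congr' fun x => ?_)
  rw [h.V_eq_actionValue_iff]
  by_cases hz : z ≤ (x : EReal)
  · simp [hz]
  · simp [hz, not_le.mp hz]

/-- Both versions of the threshold policy are optimal iff the index crosses the price there. -/
lemma Indexable.zPolicyOpt_and_zmPolicyOpt_iff (h : P.Indexable ν) (z : EReal) (lam : ℝ) :
    P.ZPolicyOpt z lam ∧ P.ZmPolicyOpt z lam ↔
      ∀ x : ℝ, (z ≤ x → lam ≤ ν x) ∧ ((x : EReal) ≤ z → ν x ≤ lam) := by
  rw [h.zPolicyOpt_iff, h.zmPolicyOpt_iff]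
  exact ⟨fun H x => ⟨(H.2 x).1, (H.1 x).2⟩, fun H =>
    ⟨fun x => ⟨fun hx => (H x).1 hx.le, (H x).2⟩, fun x => ⟨(H x).1, fun hx => (H x).2 hx.le⟩⟩⟩

end Bandit

/-- A real function is nondecreasing and continuous iff it crosses every level at an
extended-real threshold, taking that level at the threshold if this is finite. -/
lemma forall_exists_threshold_iff_monotone_continuous (ν : ℝ → ℝ) :
    (∀ lam : ℝ, ∃ z : EReal, ∀ x : ℝ,
        (z ≤ x → lam ≤ ν x) ∧ ((x : EReal) ≤ z → ν x ≤ lam)) ↔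
      Monotone ν ∧ Continuous ν := by
  constructor
  · intro H
    have hmono : Monotone ν := by
      intro x y hxy
      by_contra! hlt
      obtain ⟨lam, h1, h2⟩ := exists_between hlt
      obtain ⟨z, hz⟩ := H lam
      have hzx : z ≤ x := (not_le.mp fun hx => h2.not_ge ((hz x).2 hx)).le
      exact h1.not_ge ((hz y).1 (hzx.trans (EReal.coe_le_coe_iff.mpr hxy)))
    have hattain : ∀ {a b lam : ℝ}, ν a < lam → lam < ν b → ∃ z, ν z = lam := by
      intro a b lam ha hb
      obtain ⟨z, hz⟩ := H lam
      induction z with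
      | bot => exact absurd ((hz a).1 bot_le) ha.not_ge
      | top => exact absurd ((hz b).2 le_top) hb.not_ge
      | coe z => exact ⟨z, le_antisymm ((hz z).2 le_rfl) ((hz z).1 le_rfl)⟩
    refine ⟨hmono, continuous_iff_continuousAt.mpr fun x => tendsto_order.mpr ⟨?_, ?_⟩⟩
    · intro b hb
      obtain ⟨lam, h1, h2⟩ := exists_between hb
      by_cases hex : ∃ y, ν y < lam
      · obtain ⟨y, hy⟩ := hex
        obtain ⟨z, rfl⟩ := hattain hy h2
        filter_upwards [lt_mem_nhds (hmono.reflect_lt h2)] with t ht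
        exact h1.trans_le (hmono ht.le)
      · push Not at hex
        exact Eventually.of_forall fun y => h1.trans_le (hex y)
    · intro b hb
      obtain ⟨lam, h1, h2⟩ := exists_between hb
      by_cases hex : ∃ y, lam < ν y
      · obtain ⟨y, hy⟩ := hex
        obtain ⟨z, rfl⟩ := hattain h1 hy
        filter_upwards [gt_mem_nhds (hmono.reflect_lt h1)] with t ht
        exact (hmono ht.le).trans_lt h2
      · push Not at hex
        exact Eventually.of_forall fun y => (hex y).trans_lt h2
  · rintro ⟨hmono, hcont⟩ lam
    by_cases hle : ∀ x, ν x ≤ lam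
    · exact ⟨⊤, fun x => ⟨fun hx => absurd hx (EReal.coe_lt_top x).not_ge, fun _ => hle x⟩⟩
    by_cases hge : ∀ x, lam ≤ ν x
    · exact ⟨⊥, fun x => ⟨fun _ => hge x, fun hx => absurd hx (EReal.bot_lt_coe x).not_ge⟩⟩
    push Not at hle hge
    obtain ⟨b, hb⟩ := hle
    obtain ⟨a, ha⟩ := hge
    obtain ⟨z, rfl⟩ := mem_range_of_exists_le_of_exists_ge hcont ⟨a, ha.le⟩ ⟨b, hb.le⟩
    exact ⟨z, fun x => ⟨fun hx => hmono (EReal.coe_le_coe_iff.mp hx),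
      fun hx => hmono (EReal.coe_le_coe_iff.mp hx)⟩⟩

/-- An indexable project with index `λ*` is strongly threshold-indexable iff
its index is monotone nondecreasing and continuous. -/
theorem strongThresholdIndexable_iff_monotone_continuous (P : Bandit)
    (lamStar : ℝ → ℝ) (h : P.Indexable lamStar) :
    P.StronglyThresholdIndexable lamStar ↔
      Monotone lamStar ∧ Continuous lamStar := by
  rw [← forall_exists_threshold_iff_monotone_continuous]
  simp only [Bandit.StronglyThresholdIndexable, h.zPolicyOpt_and_zmPolicyOpt_iff]
  exact and_iff_right h
end
end
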